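/- (Proposition 1) Fix a natural number M, reals β > 0, η > 0, P_t > 0, σ > 0, b ∈ ℝ, a > 0, P_max > 0, and P_RIS with 0 ≤ P_RIS < P_max. Let f be the nonlinear energy-harvesting model with parameters a, b, P_max, set c₀ := b − (1/a)·log(P_max/(P_RIS·(1 − 1/(1 + exp(a·b))) + P_max/(1 + exp(a·b))) − 1), and let m₀ := ⌈c₀/(η·P_t·β)⌉ (integer ceiling); assume 0 ≤ m₀ ≤ M. Let r : Fin M → ℝ satisfy r(k) ≥ 0 for all k, and let T be any top set for r with card(Fin M \ T) = m₀, i.e., card T = M − m₀. Then: (i) f(η·P_t·β·m₀) ≥ P_RIS, so the allocation with reflecting set T and harvesting set Tᶜ satisfies the RIS power-consumption constraint; and (ii) for every finset R of Fin M such that f(η·P_t·β·(M − card R)) ≥ P_RIS, one has (P_t/σ²)·β·(∑_{k∈R} r(k))² ≤ (P_t/σ²)·β·(∑_{k∈T} r(k))². Hence, under equal-gain propagation in the TX-RIS link, dedicating the m₀ unit cells with smallest RIS-RX gains to harvesting and the remaining ones to reflection maximizes the end-to-end SNR subject to the harvesting constraint. -/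

import Mathlib

/-- The nonlinear energy-harvesting model with parameters `a`, `b`, `Pmax` (eq. (6)). -/
noncomputable def ehModel (a b Pmax : ℝ) (x : ℝ) : ℝ :=
  (Pmax / (1 + Real.exp (-a * (x - b))) - Pmax / (1 + Real.exp (a * b))) /
    (1 - 1 / (1 + Real.exp (a * b)))

/-- `T` is a top set for `r` if every element of `T` has a value of `r` at least as
large as every element outside `T`. -/
def IsTopSet {M : ℕ} (r : Fin M → ℝ) (T : Finset (Fin M)) : Prop :=
  ∀ i ∈ T, ∀ j ∉ T, r j ≤ r i

/-- The harvested power reaches the level `PRIS` exactly when the RF input reaches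
the value at `PRIS` of the inverse of `ehModel`. -/
lemma le_ehModel_iff {a b Pmax PRIS : ℝ} (ha : 0 < a) (hPmax : 0 < Pmax)
    (hPRIS0 : 0 ≤ PRIS) (hPRIS : PRIS < Pmax) (x : ℝ) :
    PRIS ≤ ehModel a b Pmax x ↔
      b - (1 / a) * Real.log (Pmax / (PRIS * (1 - 1 / (1 + Real.exp (a * b))) +
        Pmax / (1 + Real.exp (a * b))) - 1) ≤ x := by
  have hE : 0 < Real.exp (a * b) := Real.exp_pos _
  have hΩ0 : 0 < 1 / (1 + Real.exp (a * b)) := by positivity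
  have hΩ1 : 1 / (1 + Real.exp (a * b)) < 1 := by
    rw [div_lt_one (by positivity)]
    linarith
  rw [ehModel, div_eq_mul_one_div Pmax (1 + Real.exp (a * b))]
  generalize 1 / (1 + Real.exp (a * b)) = Ω at hΩ0 hΩ1 ⊢
  have hD0 : 0 < PRIS * (1 - Ω) + Pmax * Ω :=
    add_pos_of_nonneg_of_pos (mul_nonneg hPRIS0 (by linarith)) (by positivity)
  have hD1 : PRIS * (1 - Ω) + Pmax * Ω < Pmax := by nlinarith
  rw [le_div_iff₀ (by linarith), le_sub_iff_add_le]
  generalize PRIS * (1 - Ω) + Pmax * Ω = D at hD0 hD1 ⊢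
  have hL : 0 < Pmax / D - 1 := by
    rw [sub_pos, one_lt_div hD0]
    exact hD1
  have hexp : 0 < 1 + Real.exp (-a * (x - b)) := by positivity
  rw [le_div_iff₀ hexp, mul_comm, ← le_div_iff₀ hD0, add_comm, ← le_sub_iff_add_le,
    ← Real.le_log_iff_exp_le hL, sub_le_comm, one_div, inv_mul_eq_div, le_div_iff₀ ha]
  constructor <;> intro h <;> linarith

/-- A top set maximizes the sum of a nonnegative function among sets of no larger size. -/
lemma IsTopSet.sum_le_sum {M : ℕ} {r : Fin M → ℝ} {R T : Finset (Fin M)}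
    (hT : IsTopSet r T) (hr : ∀ k, 0 ≤ r k) (hcard : R.card ≤ T.card) :
    ∑ k ∈ R, r k ≤ ∑ k ∈ T, r k := by
  rw [← Finset.sum_sdiff_le_sum_sdiff]
  rcases (R \ T).eq_empty_or_nonempty with hempty | hne
  · rw [hempty, Finset.sum_empty]
    exact Finset.sum_nonneg fun k _ => hr k
  obtain ⟨j, hj, hmax⟩ := Finset.exists_max_image (R \ T) r hne
  calc ∑ k ∈ R \ T, r k ≤ (R \ T).card • r j := Finset.sum_le_card_nsmul _ _ _ hmax
    _ ≤ (T \ R).card • r j :=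
        nsmul_le_nsmul_left (hr j) (Finset.card_sdiff_le_card_sdiff_iff.2 hcard)
    _ ≤ ∑ k ∈ T \ R, r k := Finset.card_nsmul_le_sum _ _ _ fun i hi =>
        hT i (Finset.mem_sdiff.1 hi).1 j (Finset.mem_sdiff.1 hj).2

/-- Proposition 1: under equal-gain propagation in the TX-RIS link, dedicating the `m₀`
unit cells with smallest RIS-RX gains to harvesting (where `m₀` is the ceiling in
eq. (26)) and the remaining ones to reflection satisfies the RIS power-consumption
constraint and maximizes the end-to-end SNR among all feasible allocations. -/
theorem stmt_8 (M : ℕ) (β η Pt σ b a Pmax PRIS : ℝ)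
    (hβ : 0 < β) (hη : 0 < η) (hPt : 0 < Pt) (hσ : 0 < σ) (ha : 0 < a) (hPmax : 0 < Pmax)
    (hPRIS0 : 0 ≤ PRIS) (hPRIS : PRIS < Pmax)
    (c₀ : ℝ)
    (hc₀ : c₀ = b - (1 / a) * Real.log
      (Pmax / (PRIS * (1 - 1 / (1 + Real.exp (a * b))) + Pmax / (1 + Real.exp (a * b))) - 1))
    (m₀ : ℤ) (hm₀ : m₀ = ⌈c₀ / (η * Pt * β)⌉) (hm₀0 : 0 ≤ m₀) (hm₀M : m₀ ≤ (M : ℤ))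
    (r : Fin M → ℝ) (hr : ∀ k, 0 ≤ r k)
    (T : Finset (Fin M)) (hT : IsTopSet r T)
    (hTcard : ((Finset.univ \ T).card : ℤ) = m₀) :
    ehModel a b Pmax (η * Pt * β * (m₀ : ℝ)) ≥ PRIS ∧
    ∀ R : Finset (Fin M),
      ehModel a b Pmax (η * Pt * β * ((M : ℝ) - (R.card : ℝ))) ≥ PRIS →
      (Pt / σ ^ 2) * β * (∑ k ∈ R, r k) ^ 2 ≤ (Pt / σ ^ 2) * β * (∑ k ∈ T, r k) ^ 2 := by
  have hpos : 0 < η * Pt * β := by positivity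
  constructor
  · rw [ge_iff_le, le_ehModel_iff ha hPmax hPRIS0 hPRIS, ← hc₀, mul_comm, ← div_le_iff₀ hpos, hm₀]
    exact Int.le_ceil _
  · intro R hR
    rw [ge_iff_le, le_ehModel_iff ha hPmax hPRIS0 hPRIS, ← hc₀, mul_comm,
      ← div_le_iff₀ hpos] at hR
    have hm₀R : m₀ ≤ (M : ℤ) - (R.card : ℤ) := by
      rw [hm₀, Int.ceil_le]
      exact_mod_cast hR
    have hTM : (Finset.univ \ T).card + T.card = M := by
      rw [Finset.card_sdiff_add_card_eq_card (Finset.subset_univ T), Finset.card_fin]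
    have hsum : ∑ k ∈ R, r k ≤ ∑ k ∈ T, r k := hT.sum_le_sum hr (by omega)
    have hR0 : 0 ≤ ∑ k ∈ R, r k := Finset.sum_nonneg fun k _ => hr k
    gcongr
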